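/- arXiv:math-ph/0201057 — 2 statements merged into one kernel-verified Lean document; each statement's English description precedes it below -/
import Mathlib

section
/- Let 0 ≤ κ ≤ 1 and τ > 1. There exist constants C > 0 and λ₀ ∈ (0,1/2) such that for every λ ∈ (0,λ₀) and all real numbers a, b with a² + b² ≤ |log λ|^{−2τ}, the integral K = ∫∫_{{(x,y) ∈ ℝ² : x²+y² ≤ |log λ|^{−2τ}}} [λ + b² + y² + (a² + x²)·(1 + |log(λ + a² + b² + x² + y²)|^κ)]^{−1} dx dy satisfies K ≤ C·|log(λ + a² + b²)|^{1−κ/2}. -/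
open MeasureTheory

theorem lintegral_inv_add_mul_sq {A c : ℝ} (hA : 0 < A) (hc : 0 < c) :
    ∫⁻ u : ℝ, ENNReal.ofReal ((A + c * u ^ 2)⁻¹) = ENNReal.ofReal (Real.pi / √(A * c)) := by
  have hk : 0 < √(c / A) := Real.sqrt_pos.2 (by positivity)
  have hg : ∀ u : ℝ, (A + c * u ^ 2)⁻¹ = A⁻¹ * (1 + (√(c / A) * u) ^ 2)⁻¹ := by
    intro u
    rw [mul_pow, Real.sq_sqrt (by positivity), ← mul_inv]
    congr 1
    field_simp
  have hi : Integrable fun u : ℝ ↦ A⁻¹ * (1 + (√(c / A) * u) ^ 2)⁻¹ :=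
    (integrable_inv_one_add_sq.comp_mul_left' hk.ne').const_mul _
  simp_rw [hg]
  rw [← ofReal_integral_eq_lintegral_ofReal hi (Filter.Eventually.of_forall fun u ↦ by positivity),
    integral_const_mul, Measure.integral_comp_mul_left (fun u : ℝ ↦ (1 + u ^ 2)⁻¹),
    integral_univ_inv_one_add_sq, smul_eq_mul, abs_of_pos (inv_pos.2 hk)]
  congr 1
  rw [Real.sqrt_div hc.le, Real.sqrt_mul hA.le]
  have h1 := Real.sqrt_pos.2 hA
  have h2 := Real.sqrt_pos.2 hc
  field_simp
  rw [Real.sq_sqrt hA.le]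

theorem mul_sq_le_sin_sq {u : ℝ} (hu : |u| ≤ Real.pi / 2) :
    4 / Real.pi ^ 2 * u ^ 2 ≤ Real.sin u ^ 2 := by
  have h := Real.mul_abs_le_abs_sin hu
  have h2 := pow_le_pow_left₀ (by positivity) h 2
  rw [mul_pow, sq_abs, sq_abs, div_pow] at h2
  norm_num at h2 ⊢
  exact h2

theorem lintegral_inv_add_mul_cos_sq_le {A B : ℝ} (hA : 0 < A) (hB : 0 < B) :
    ∫⁻ θ in Set.Ioo (-Real.pi) Real.pi, ENNReal.ofReal ((A + B * Real.cos θ ^ 2)⁻¹) ≤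
      ENNReal.ofReal (Real.pi ^ 2 / √(A * B)) := by
  have hpi := Real.pi_pos
  set c : ℝ := 4 * B / Real.pi ^ 2 with hc
  have hc0 : 0 < c := by positivity
  set g : ℝ → ENNReal := fun u ↦ ENNReal.ofReal ((A + c * u ^ 2)⁻¹) with hgdef
  have hgm : Measurable g := by fun_prop
  have key : ∀ u x : ℝ, |u| ≤ Real.pi / 2 → x ^ 2 = Real.sin u ^ 2 →
      ENNReal.ofReal ((A + B * x ^ 2)⁻¹) ≤ g u := by
    intro u x hu hx
    apply ENNReal.ofReal_le_ofReal
    apply inv_anti₀ (by positivity)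
    have := mul_le_mul_of_nonneg_left (mul_sq_le_sin_sq hu) hB.le
    rw [hx, hc]
    calc _ = A + B * (4 / Real.pi ^ 2 * u ^ 2) := by ring
      _ ≤ _ := by linarith
  have hle : ∀ θ ∈ Set.Ioo (-Real.pi) Real.pi,
      ENNReal.ofReal ((A + B * Real.cos θ ^ 2)⁻¹) ≤
        g (θ - Real.pi / 2) + g (θ + Real.pi / 2) := by
    rintro θ ⟨h1, h2⟩
    rcases le_total 0 θ with h | h
    · refine (key (θ - Real.pi / 2) _ ?_ ?_).trans le_self_add
      · rw [abs_le]; constructor <;> linarith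
      · rw [Real.sin_sub_pi_div_two, neg_sq]
    · refine (key (θ + Real.pi / 2) _ ?_ ?_).trans le_add_self
      · rw [abs_le]; constructor <;> linarith
      · rw [Real.sin_add_pi_div_two]
  calc _ ≤ ∫⁻ θ in Set.Ioo (-Real.pi) Real.pi, (g (θ - Real.pi / 2) + g (θ + Real.pi / 2)) :=
        setLIntegral_mono' measurableSet_Ioo hle
    _ ≤ ∫⁻ θ, (g (θ - Real.pi / 2) + g (θ + Real.pi / 2)) := setLIntegral_le_lintegral _ _
    _ = (∫⁻ θ, g θ) + ∫⁻ θ, g θ := by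
        rw [lintegral_add_left (by fun_prop), lintegral_sub_right_eq_self g,
          lintegral_add_right_eq_self g]
    _ = _ := by
        rw [hgdef, lintegral_inv_add_mul_sq hA hc0, ← ENNReal.ofReal_add (by positivity)
          (by positivity)]
        congr 1
        have : A * c = (A * B) * (2 / Real.pi) ^ 2 := by rw [hc]; ring
        rw [this, Real.sqrt_mul (by positivity), Real.sqrt_sq (by positivity)]
        have := Real.sqrt_pos.2 (mul_pos hA hB)
        field_simp
        norm_num

theorem lintegral_div_mul_log_rpow_le {κ σ p q : ℝ} (hκ1 : κ ≤ 1) (hσ : 0 < σ)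
    (hp : 0 ≤ p) (hq : σ + q ^ 2 < 1) :
    ∫⁻ r in Set.Ioc p q, ENNReal.ofReal
        (r / (σ + r ^ 2) * (-Real.log (σ + r ^ 2)) ^ (-(κ / 2))) ≤
      ENNReal.ofReal ((-Real.log σ) ^ (1 - κ / 2)) := by
  rcases lt_or_ge q p with hqp | hpq
  · simp [Set.Ioc_eq_empty_of_le hqp.le]
  have hA : ∀ r : ℝ, 0 < σ + r ^ 2 := fun r ↦ by positivity
  have hlog : ∀ r ∈ Set.Icc p q, 0 < -Real.log (σ + r ^ 2) := by
    rintro r ⟨h1, h2⟩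
    have : r ^ 2 ≤ q ^ 2 := pow_le_pow_left₀ (hp.trans h1) h2 2
    linarith [Real.log_neg (hA r) (by linarith)]
  set f : ℝ → ℝ := fun r ↦ r / (σ + r ^ 2) * (-Real.log (σ + r ^ 2)) ^ (-(κ / 2)) with hf
  have hcont : ContinuousOn f (Set.Icc p q) := by
    intro r hr
    apply ContinuousAt.continuousWithinAt
    refine ContinuousAt.mul ?_ ?_
    · exact ContinuousAt.div (by fun_prop) (by fun_prop) (hA r).ne'
    · refine ContinuousAt.rpow_const ?_ (Or.inl (hlog r hr).ne')
      have h : ContinuousAt (fun r : ℝ ↦ σ + r ^ 2) r := by fun_prop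
      exact (h.log (hA r).ne').neg
  have hint : IntervalIntegrable f volume p q := hcont.intervalIntegrable_of_Icc hpq
  have hderiv : ∀ r ∈ Set.uIcc p q, HasDerivAt
      (fun r ↦ -(2 - κ)⁻¹ * (-Real.log (σ + r ^ 2)) ^ (1 - κ / 2)) (f r) r := by
    intro r hr
    rw [Set.uIcc_of_le hpq] at hr
    have h1 : HasDerivAt (fun r : ℝ ↦ σ + r ^ 2) (2 * r) r := by
      simpa using (hasDerivAt_pow 2 r).const_add σ
    have h2 := ((h1.log (hA r).ne').neg.rpow_const (p := 1 - κ / 2)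
      (Or.inl (hlog r hr).ne')).const_mul (-(2 - κ)⁻¹)
    refine h2.congr_deriv ?_
    have e : 1 - κ / 2 - 1 = -(κ / 2) := by ring
    simp only [hf, e, Pi.neg_apply]
    have h3 : (2 - κ) ≠ 0 := by linarith
    have h4 := (hA r).ne'
    field_simp
  have hval := intervalIntegral.integral_eq_sub_of_hasDerivAt hderiv hint
  rw [intervalIntegral.integral_of_le hpq] at hval
  have hnn : ∀ r ∈ Set.Ioc p q, 0 ≤ f r := by
    intro r hr
    exact mul_nonneg (div_nonneg (hp.trans hr.1.le) (hA r).le)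
      (Real.rpow_nonneg (hlog r ⟨hr.1.le, hr.2⟩).le _)
  rw [← ofReal_integral_eq_lintegral_ofReal
    ((intervalIntegrable_iff_integrableOn_Ioc_of_le hpq).1 hint)
    ((ae_restrict_iff' measurableSet_Ioc).2 (Filter.Eventually.of_forall hnn)), hval]
  apply ENNReal.ofReal_le_ofReal
  have h1 : (-Real.log (σ + p ^ 2)) ^ (1 - κ / 2) ≤ (-Real.log σ) ^ (1 - κ / 2) := by
    apply Real.rpow_le_rpow (hlog p ⟨le_rfl, hpq⟩).le _ (by linarith)
    exact neg_le_neg (Real.log_le_log hσ (by nlinarith))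
  have h2 : 0 ≤ (-Real.log (σ + q ^ 2)) ^ (1 - κ / 2) :=
    Real.rpow_nonneg (hlog q ⟨hpq, le_rfl⟩).le _
  have h3 : (2 - κ)⁻¹ ≤ 1 := inv_le_one_of_one_le₀ (by linarith)
  have h4 : 0 ≤ (2 - κ)⁻¹ := inv_nonneg.2 (by linarith)
  have h5 : 0 ≤ (-Real.log (σ + p ^ 2)) ^ (1 - κ / 2) :=
    Real.rpow_nonneg (hlog p ⟨le_rfl, hpq⟩).le _
  nlinarith [mul_nonneg h4 h2, mul_le_mul_of_nonneg_right h3 h5]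

theorem setLIntegral_disk_eq_polar {f : ℝ × ℝ → ENNReal} (hf : Measurable f) {q : ℝ}
    (hq : 0 ≤ q) :
    ∫⁻ v in {v : ℝ × ℝ | v.1 ^ 2 + v.2 ^ 2 ≤ q ^ 2}, f v =
      ∫⁻ r in Set.Ioc 0 q, ENNReal.ofReal r *
        ∫⁻ θ in Set.Ioo (-Real.pi) Real.pi, f (r * Real.cos θ, r * Real.sin θ) := by
  have hD : MeasurableSet {v : ℝ × ℝ | v.1 ^ 2 + v.2 ^ 2 ≤ q ^ 2} :=
    measurableSet_le (by fun_prop) (by fun_prop)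
  rw [← lintegral_indicator hD, ← lintegral_comp_polarCoord_symm]
  change ∫⁻ p in Set.Ioi (0 : ℝ) ×ˢ Set.Ioo (-Real.pi) Real.pi, ENNReal.ofReal p.1 *
    Set.indicator _ f (p.1 * Real.cos p.2, p.1 * Real.sin p.2) = _
  have hm : Measurable fun p : ℝ × ℝ ↦ ENNReal.ofReal p.1 *
      Set.indicator {v : ℝ × ℝ | v.1 ^ 2 + v.2 ^ 2 ≤ q ^ 2} f
        (p.1 * Real.cos p.2, p.1 * Real.sin p.2) :=
    (by fun_prop : Measurable fun p : ℝ × ℝ ↦ ENNReal.ofReal p.1).mul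
      ((hf.indicator hD).comp (by fun_prop))
  rw [Measure.volume_eq_prod, ← Measure.prod_restrict, lintegral_prod _ hm.aemeasurable,
    ← Set.Ioi_inter_Iic, Set.inter_comm, ← setLIntegral_indicator measurableSet_Iic]
  refine setLIntegral_congr_fun measurableSet_Ioi fun r hr ↦ ?_
  have hr : 0 < r := hr
  have hmem : ∀ θ : ℝ, ((r * Real.cos θ, r * Real.sin θ) ∈
      {v : ℝ × ℝ | v.1 ^ 2 + v.2 ^ 2 ≤ q ^ 2}) ↔ r ≤ q := by
    intro θ
    have : (r * Real.cos θ) ^ 2 + (r * Real.sin θ) ^ 2 = r ^ 2 := by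
      linear_combination r ^ 2 * Real.sin_sq_add_cos_sq θ
    rw [Set.mem_ofPred_eq, this, sq_le_sq₀ hr.le hq]
  rw [lintegral_const_mul' _ _ ENNReal.ofReal_ne_top]
  by_cases h : r ≤ q <;> simp [Set.indicator, h, hmem, -Set.mem_ofPred_eq]

theorem angular_lintegral_le {r A m : ℝ} (hA : 0 < A) (hm : 0 ≤ m) :
    ∫⁻ θ in Set.Ioo (-Real.pi) Real.pi, ENNReal.ofReal ((A + (r * Real.cos θ) ^ 2 * m)⁻¹) ≤
      ENNReal.ofReal (2 * Real.pi / A) := by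
  calc _ ≤ ∫⁻ θ in Set.Ioo (-Real.pi) Real.pi, ENNReal.ofReal (A⁻¹) := by
        refine lintegral_mono fun θ ↦ ENNReal.ofReal_le_ofReal (inv_anti₀ hA ?_)
        exact le_add_of_nonneg_right (by positivity)
    _ = _ := by
        rw [setLIntegral_const, Real.volume_Ioo, ← ENNReal.ofReal_mul (by positivity)]
        congr 1
        ring

theorem lintegral_disk_le {κ σ q : ℝ} (hκ1 : κ ≤ 1) (hσ : 0 < σ)
    (hq0 : 0 ≤ q) (hq : σ + q ^ 2 < 1) :
    ∫⁻ v in {v : ℝ × ℝ | v.1 ^ 2 + v.2 ^ 2 ≤ q ^ 2}, ENNReal.ofReal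
        ((σ + v.1 ^ 2 + v.2 ^ 2 + v.1 ^ 2 * |Real.log (σ + v.1 ^ 2 + v.2 ^ 2)| ^ κ)⁻¹) ≤
      ENNReal.ofReal (2 * Real.pi + 2 * Real.pi ^ 2 * (-Real.log σ) ^ (1 - κ / 2)) := by
  have hpi := Real.pi_pos
  rw [setLIntegral_disk_eq_polar (by fun_prop) hq0]
  have hrw : ∀ r θ : ℝ, σ + (r * Real.cos θ) ^ 2 + (r * Real.sin θ) ^ 2 = σ + r ^ 2 := by
    intro r θ
    linear_combination r ^ 2 * Real.sin_sq_add_cos_sq θ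
  simp_rw [hrw]
  set H : ℝ → ENNReal := fun r ↦ ENNReal.ofReal r *
    ∫⁻ θ in Set.Ioo (-Real.pi) Real.pi, ENNReal.ofReal
      ((σ + r ^ 2 + (r * Real.cos θ) ^ 2 * |Real.log (σ + r ^ 2)| ^ κ)⁻¹) with hH
  have hlogσ : 0 ≤ -Real.log σ :=
    neg_nonneg.2 (Real.log_nonpos hσ.le (by nlinarith [sq_nonneg q]))
  have hs := Real.sqrt_pos.2 hσ
  have hinner : ∫⁻ r in Set.Ioc 0 √σ, H r ≤ ENNReal.ofReal (2 * Real.pi) := by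
    calc _ ≤ ∫⁻ r in Set.Ioc 0 √σ, ENNReal.ofReal (2 * Real.pi / √σ) := by
          refine setLIntegral_mono' measurableSet_Ioc fun r hr ↦ ?_
          refine (mul_le_mul_right (angular_lintegral_le (by positivity)
            (by positivity)) _).trans ?_
          rw [← ENNReal.ofReal_mul hr.1.le]
          apply ENNReal.ofReal_le_ofReal
          rw [← mul_div_assoc, div_le_div_iff₀ (by positivity) hs]
          have : r * √σ ≤ σ := by
            nlinarith [mul_le_mul_of_nonneg_right hr.2 hs.le, Real.mul_self_sqrt hσ.le]
          nlinarith [sq_nonneg r]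
      _ = _ := by
          rw [setLIntegral_const, Real.volume_Ioc, ← ENNReal.ofReal_mul (by positivity)]
          congr 1
          rw [sub_zero, div_mul_cancel₀ _ hs.ne']
  have houter : ∫⁻ r in Set.Ioc √σ q, H r ≤
      ENNReal.ofReal (2 * Real.pi ^ 2 * (-Real.log σ) ^ (1 - κ / 2)) := by
    rw [ENNReal.ofReal_mul (by positivity)]
    refine le_trans ?_ (mul_le_mul_right
      (lintegral_div_mul_log_rpow_le hκ1 hσ (Real.sqrt_nonneg σ) hq) _)
    rw [← lintegral_const_mul' _ _ ENNReal.ofReal_ne_top]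
    refine setLIntegral_mono' measurableSet_Ioc fun r hr ↦ ?_
    have hr0 : 0 < r := hs.trans hr.1
    have hA : 0 < σ + r ^ 2 := by positivity
    have hσr : σ ≤ r ^ 2 := by
      rw [← Real.sq_sqrt hσ.le]
      exact pow_le_pow_left₀ hs.le hr.1.le 2
    have hrq : r ^ 2 ≤ q ^ 2 := pow_le_pow_left₀ hr0.le hr.2 2
    have hlog : 0 < -Real.log (σ + r ^ 2) := by
      linarith [Real.log_neg hA (by linarith)]
    have habs : |Real.log (σ + r ^ 2)| = -Real.log (σ + r ^ 2) := abs_of_neg (by linarith)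
    set A := σ + r ^ 2 with hAdef
    set m := (-Real.log A) ^ (κ / 2) with hm
    have hm0 : 0 < m := Real.rpow_pos_of_pos hlog _
    have hm2 : (-Real.log A) ^ κ = m ^ 2 := by
      rw [hm, ← Real.rpow_mul_natCast hlog.le]
      congr 1
      push_cast
      ring
    have hang := lintegral_inv_add_mul_cos_sq_le hA
      (B := r ^ 2 * m ^ 2) (by positivity)
    simp only [hH, ← hAdef]
    rw [habs, hm2]
    have hcong : ∀ θ : ℝ, A + (r * Real.cos θ) ^ 2 * m ^ 2 =
        A + r ^ 2 * m ^ 2 * Real.cos θ ^ 2 := fun θ ↦ by ring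
    simp_rw [hcong]
    refine (mul_le_mul_right hang _).trans ?_
    rw [← ENNReal.ofReal_mul hr0.le, ← ENNReal.ofReal_mul (by positivity)]
    apply ENNReal.ofReal_le_ofReal
    rw [Real.rpow_neg hlog.le, ← hm]
    have hsq : A * m / 2 ≤ √(A * (r ^ 2 * m ^ 2)) := by
      apply Real.le_sqrt_of_sq_le
      have h1 : A / 4 ≤ r ^ 2 := by linarith
      have h2 := mul_le_mul_of_nonneg_left h1 (by positivity : 0 ≤ A * m ^ 2)
      linarith
    calc _ ≤ r * (Real.pi ^ 2 / (A * m / 2)) := by gcongr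
      _ = _ := by field_simp
  calc _ ≤ ∫⁻ r in Set.Ioc 0 √σ ∪ Set.Ioc √σ q, H r :=
        lintegral_mono_set Set.Ioc_subset_Ioc_union_Ioc
    _ ≤ _ := lintegral_union_le _ _ _
    _ ≤ _ := add_le_add hinner houter
    _ = _ := by
        rw [← ENNReal.ofReal_add (by positivity)]
        exact mul_nonneg (by positivity) (Real.rpow_nonneg hlogσ _)

/-- upper bound of Lemma `le:up`. For `0 ≤ κ ≤ 1 < τ` there are `C > 0`
and `λ₀ ∈ (0,1/2)` such that for `λ ∈ (0,λ₀)` and `a² + b² ≤ |log λ|^{−2τ}`, the integral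
`K = ∫∫_{x²+y² ≤ |log λ|^{−2τ}} [λ + b² + y² + (a²+x²)(1 + |log(λ+a²+b²+x²+y²)|^κ)]⁻¹ dx dy`
satisfies `K ≤ C·|log(λ+a²+b²)|^{1−κ/2}`. -/
theorem stmt1 (κ τ : ℝ) (hκ0 : 0 ≤ κ) (hκ1 : κ ≤ 1) (hτ : 1 < τ) :
    ∃ C : ℝ, 0 < C ∧ ∃ lam0 : ℝ, 0 < lam0 ∧ lam0 < 1 / 2 ∧
      ∀ l : ℝ, 0 < l → l < lam0 → ∀ a b : ℝ,
        a ^ 2 + b ^ 2 ≤ |Real.log l| ^ (-(2 * τ)) →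
        (∫ v in {v : ℝ × ℝ | v.1 ^ 2 + v.2 ^ 2 ≤ |Real.log l| ^ (-(2 * τ))},
            (l + b ^ 2 + v.2 ^ 2 +
              (a ^ 2 + v.1 ^ 2) *
                (1 + |Real.log (l + a ^ 2 + b ^ 2 + v.1 ^ 2 + v.2 ^ 2)| ^ κ))⁻¹)
          ≤ C * |Real.log (l + a ^ 2 + b ^ 2)| ^ (1 - κ / 2) := by
  have hpi := Real.pi_pos
  have he : Real.exp (-10) < 1 / 10 := by
    rw [Real.exp_neg, one_div]
    exact inv_strictAnti₀ (by norm_num) (by linarith [Real.add_one_le_exp (10 : ℝ)])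
  refine ⟨2 * Real.pi + 2 * Real.pi ^ 2, by positivity, Real.exp (-10), Real.exp_pos _,
    by linarith, fun l hl hl0 a b hab ↦ ?_⟩
  set ρ := |Real.log l| ^ (-(2 * τ)) with hρ
  have hL : 10 ≤ |Real.log l| := by
    have : Real.log l < -10 := (Real.log_lt_iff_lt_exp hl).2 hl0
    rw [abs_of_neg (by linarith)]
    linarith
  have hρ0 : 0 ≤ ρ := Real.rpow_nonneg (abs_nonneg _) _
  have hρ1 : ρ ≤ 1 / 10 := by
    calc ρ ≤ |Real.log l| ^ (-1 : ℝ) :=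
          Real.rpow_le_rpow_of_exponent_le (by linarith) (by linarith)
      _ ≤ 1 / 10 := by
          rw [Real.rpow_neg_one, one_div]
          exact inv_anti₀ (by norm_num) hL
  set σ := l + a ^ 2 + b ^ 2 with hσdef
  have hσ : 0 < σ := by positivity
  have hσ1 : σ ≤ 1 / 5 := by linarith
  have hlog : Real.log σ ≤ -1 := by
    rw [Real.log_le_iff_le_exp hσ]
    linarith [Real.exp_neg_one_gt_d9]
  have hM : 1 ≤ (-Real.log σ) ^ (1 - κ / 2) :=
    Real.one_le_rpow (by linarith) (by linarith)
  have hq : √ρ ^ 2 = ρ := Real.sq_sqrt hρ0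
  rw [abs_of_neg (by linarith : Real.log σ < 0),
    integral_eq_lintegral_of_nonneg_ae (Filter.Eventually.of_forall fun v ↦ by positivity)
      (by fun_prop : Measurable _).aestronglyMeasurable]
  refine ENNReal.toReal_le_of_le_ofReal (by positivity) ?_
  calc _ ≤ _ := lintegral_mono fun v ↦ ENNReal.ofReal_le_ofReal (inv_anti₀
        (b := σ + v.1 ^ 2 + v.2 ^ 2 + v.1 ^ 2 * |Real.log (σ + v.1 ^ 2 + v.2 ^ 2)| ^ κ)
        (by positivity) ?_)
    _ ≤ ENNReal.ofReal (2 * Real.pi + 2 * Real.pi ^ 2 * (-Real.log σ) ^ (1 - κ / 2)) := by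
        rw [← hq]
        exact lintegral_disk_le hκ1 hσ (Real.sqrt_nonneg ρ) (by linarith)
    _ ≤ _ := by
        apply ENNReal.ofReal_le_ofReal
        nlinarith
  have h : 0 ≤ a ^ 2 * |Real.log (σ + v.1 ^ 2 + v.2 ^ 2)| ^ κ := by positivity
  linarith
end

section
/- Let 0 ≤ κ ≤ 1 and τ > 1. There exist constants C > 0 and λ₀ ∈ (0,1/2) such that for every λ ∈ (0,λ₀) and all real numbers a, b with a² + b² ≤ |log λ|^{−4τ}, the integral K = ∫∫_{{(x,y) ∈ ℝ² : x²+y² ≤ |log λ|^{−2τ}}} [λ + b² + y² + (a² + x²)·(1 + |log(λ + a² + b² + x² + y²)|^κ)]^{−1} dx dy satisfies K ≥ C^{−1}·|log(λ + a² + b²)|^{1−κ/2}. -/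
open MeasureTheory

theorem isClosed_trapezoid (m X c : ℝ) :
    IsClosed {v : ℝ × ℝ | v.1 ∈ Set.Icc m X ∧ v.2 ∈ Set.Icc 0 (c * v.1)} := by
  simp only [Set.mem_Icc, Set.ofPred_and]
  exact ((isClosed_le (by fun_prop) (by fun_prop)).inter
    (isClosed_le (by fun_prop) (by fun_prop))).inter
    ((isClosed_le (by fun_prop) (by fun_prop)).inter (isClosed_le (by fun_prop) (by fun_prop)))

/-- The integral of `1 / (3 q x²)` over the trapezoid `m ≤ x ≤ X`, `0 ≤ y ≤ √q x`. -/
theorem setIntegral_trapezoid {q m X : ℝ} (hq : 0 < q) (hm : 0 < m) (hmX : m ≤ X) :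
    IntegrableOn (fun v : ℝ × ℝ => (3 * q * v.1 ^ 2)⁻¹)
      {v : ℝ × ℝ | v.1 ∈ Set.Icc m X ∧ v.2 ∈ Set.Icc 0 (√q * v.1)} ∧
    ∫ v in {v : ℝ × ℝ | v.1 ∈ Set.Icc m X ∧ v.2 ∈ Set.Icc 0 (√q * v.1)},
      (3 * q * v.1 ^ 2)⁻¹ = (3 * √q)⁻¹ * Real.log (X / m) := by
  set T : Set (ℝ × ℝ) := {v : ℝ × ℝ | v.1 ∈ Set.Icc m X ∧ v.2 ∈ Set.Icc 0 (√q * v.1)} with hT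
  have hsq : 0 < √q := Real.sqrt_pos.2 hq
  have hTc : IsClosed T := isClosed_trapezoid m X √q
  have hTK : IsCompact T := by
    refine (isCompact_Icc (a := ((m, 0) : ℝ × ℝ)) (b := (X, √q * X))).of_isClosed_subset hTc ?_
    rintro ⟨x, y⟩ ⟨⟨h1, h2⟩, h3, h4⟩
    exact ⟨⟨h1, h3⟩, ⟨h2, h4.trans (by dsimp only; gcongr)⟩⟩
  have hint : IntegrableOn (fun v : ℝ × ℝ => (3 * q * v.1 ^ 2)⁻¹) T := by
    refine ContinuousOn.integrableOn_compact hTK (ContinuousOn.inv₀ (by fun_prop) ?_)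
    rintro ⟨x, y⟩ ⟨⟨h1, h2⟩, h3, h4⟩
    have : 0 < x := hm.trans_le h1
    positivity
  refine ⟨hint, ?_⟩
  rw [← integral_indicator hTc.measurableSet, Measure.volume_eq_prod, integral_prod]
  swap
  · rw [← Measure.volume_eq_prod]
    exact hint.integrable_indicator hTc.measurableSet
  have hin : ∀ x : ℝ, (∫ y, T.indicator (fun v : ℝ × ℝ => (3 * q * v.1 ^ 2)⁻¹) (x, y)) =
      (Set.Icc m X).indicator (fun x => (3 * √q)⁻¹ * x⁻¹) x := by
    intro x
    by_cases hx : x ∈ Set.Icc m X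
    · have hx0 : 0 < x := hm.trans_le hx.1
      have h : ∀ y, T.indicator (fun v : ℝ × ℝ => (3 * q * v.1 ^ 2)⁻¹) (x, y) =
          (Set.Icc 0 (√q * x)).indicator (fun _ => (3 * q * x ^ 2)⁻¹) y := by
        intro y
        by_cases hy : y ∈ Set.Icc 0 (√q * x)
        · rw [Set.indicator_of_mem hy, Set.indicator_of_mem (show (x, y) ∈ T from ⟨hx, hy⟩)]
        · rw [Set.indicator_of_notMem hy,
            Set.indicator_of_notMem (show (x, y) ∉ T from fun h => hy h.2)]
      simp_rw [h]
      rw [integral_indicator measurableSet_Icc, Set.indicator_of_mem hx, setIntegral_const,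
        Measure.real, Real.volume_Icc, sub_zero, ENNReal.toReal_ofReal (by positivity), smul_eq_mul]
      have h2 : q = √q * √q := (Real.mul_self_sqrt hq.le).symm
      rw [h2, Real.sqrt_mul_self hsq.le]
      field_simp
    · have h : ∀ y, T.indicator (fun v : ℝ × ℝ => (3 * q * v.1 ^ 2)⁻¹) (x, y) = 0 := fun y =>
        Set.indicator_of_notMem (fun h => hx h.1) _
      rw [Set.indicator_of_notMem hx]
      simp_rw [h]
      exact integral_zero _ _
  simp_rw [hin]
  rw [integral_indicator measurableSet_Icc, integral_Icc_eq_integral_Ioc,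
    ← intervalIntegral.integral_of_le hmX, intervalIntegral.integral_const_mul,
    integral_inv_of_pos hm (hm.trans_le hmX)]

/-- The lower bound for the integral over a disk of squared radius `P`, when
`s = l + a² + b²` is at most `2 P²` and `-log s` is large. -/
theorem rpow_le_setIntegral_disk {κ l a b P : ℝ} (hκ0 : 0 ≤ κ) (hκ1 : κ ≤ 1) (hl : 0 < l)
    (hP : 0 < P) (hP1 : P ≤ 1 / 2) (hs : l + a ^ 2 + b ^ 2 ≤ 2 * P ^ 2)
    (hM : 20 ≤ -Real.log (l + a ^ 2 + b ^ 2)) :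
    (96 : ℝ)⁻¹ * |Real.log (l + a ^ 2 + b ^ 2)| ^ (1 - κ / 2) ≤
      ∫ v in {v : ℝ × ℝ | v.1 ^ 2 + v.2 ^ 2 ≤ P},
        (l + b ^ 2 + v.2 ^ 2 +
          (a ^ 2 + v.1 ^ 2) *
            (1 + |Real.log (l + a ^ 2 + b ^ 2 + v.1 ^ 2 + v.2 ^ 2)| ^ κ))⁻¹ := by
  set s := l + a ^ 2 + b ^ 2 with hsdef
  have hs0 : 0 < s := by positivity
  set M := -Real.log s with hMdef
  have habs : |Real.log s| = M := abs_of_nonpos (by linarith)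
  have hM0 : 0 < M := by linarith
  set q := 1 + M ^ κ with hqdef
  have hMk1 : 1 ≤ M ^ κ := Real.one_le_rpow (by linarith) hκ0
  have hMkM : M ^ κ ≤ M := by
    simpa using Real.rpow_le_rpow_of_exponent_le (by linarith : (1:ℝ) ≤ M) hκ1
  have hq : 0 < q := by positivity
  set X := √(P / (1 + q)) with hX
  have hX0 : 0 < X := by positivity
  have hm0 : 0 < √s := by positivity
  have hlog : M / 16 ≤ Real.log (X / √s) := by
    have h1 : Real.log (X / √s) = (Real.log P - Real.log (1 + q) + M) / 2 := by
      rw [Real.log_div hX0.ne' hm0.ne', hX, Real.log_sqrt (by positivity), Real.log_sqrt hs0.le,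
        Real.log_div hP.ne' (by positivity)]
      ring
    have h2 : Real.log s ≤ Real.log 2 + 2 * Real.log P := by
      have := Real.log_le_log hs0 hs
      rwa [Real.log_mul (by norm_num) (by positivity), Real.log_pow] at this
    have h3 : Real.log (1 + q) ≤ Real.log 64 + (M / 16 - 1) := by
      have h4 : Real.log (1 + q) ≤ Real.log (64 * (M / 16)) :=
        Real.log_le_log (by positivity) (by linarith)
      rw [Real.log_mul (by norm_num) (by positivity)] at h4
      linarith [Real.log_le_sub_one_of_pos (show 0 < M / 16 by positivity)]
    have h5 : Real.log 64 = 6 * Real.log 2 := by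
      rw [show (64 : ℝ) = 2 ^ 6 by norm_num, Real.log_pow]; norm_num
    linarith [Real.log_two_lt_d9]
  have hmX : √s ≤ X := by
    have : 0 ≤ Real.log (X / √s) := by linarith
    rw [Real.log_nonneg_iff (by positivity), one_le_div hm0] at this
    exact this
  obtain ⟨hgint, hgval⟩ := setIntegral_trapezoid hq hm0 hmX
  set T : Set (ℝ × ℝ) := {v : ℝ × ℝ | v.1 ∈ Set.Icc (√s) X ∧ v.2 ∈ Set.Icc 0 (√q * v.1)} with hT
  set D : Set (ℝ × ℝ) := {v : ℝ × ℝ | v.1 ^ 2 + v.2 ^ 2 ≤ P} with hD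
  set F : ℝ × ℝ → ℝ := fun v => (l + b ^ 2 + v.2 ^ 2 +
          (a ^ 2 + v.1 ^ 2) * (1 + |Real.log (s + v.1 ^ 2 + v.2 ^ 2)| ^ κ))⁻¹ with hF
  have hFden : ∀ v : ℝ × ℝ, 0 < l + b ^ 2 + v.2 ^ 2 +
          (a ^ 2 + v.1 ^ 2) * (1 + |Real.log (s + v.1 ^ 2 + v.2 ^ 2)| ^ κ) := fun v => by positivity
  have hFcont : Continuous F := by
    refine Continuous.inv₀ ?_ fun v => (hFden v).ne'
    have h1 : Continuous fun v : ℝ × ℝ => Real.log (s + v.1 ^ 2 + v.2 ^ 2) :=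
      Continuous.log (by fun_prop) fun v => by positivity
    have h2 : Continuous fun v : ℝ × ℝ => |Real.log (s + v.1 ^ 2 + v.2 ^ 2)| ^ κ :=
      h1.abs.rpow_const fun v => Or.inr hκ0
    fun_prop
  have hDc : IsClosed D := isClosed_le (by fun_prop) (by fun_prop)
  have hDK : IsCompact D := by
    refine (isCompact_Icc (a := ((-1, -1) : ℝ × ℝ)) (b := (1, 1))).of_isClosed_subset hDc ?_
    rintro ⟨x, y⟩ h
    have h : x ^ 2 + y ^ 2 ≤ P := h
    have hx : |x| ≤ 1 := abs_le_one_iff_mul_self_le_one.2 (by nlinarith [sq_nonneg y])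
    have hy : |y| ≤ 1 := abs_le_one_iff_mul_self_le_one.2 (by nlinarith [sq_nonneg x])
    rw [abs_le] at hx hy
    exact ⟨⟨hx.1, hy.1⟩, ⟨hx.2, hy.2⟩⟩
  have hFint : IntegrableOn F D := hFcont.continuousOn.integrableOn_compact hDK
  have hTsq : ∀ v ∈ T, s ≤ v.1 ^ 2 ∧ v.2 ^ 2 ≤ q * v.1 ^ 2 ∧ (1 + q) * v.1 ^ 2 ≤ P := by
    rintro ⟨x, y⟩ ⟨⟨h1, h2⟩, h3, h4⟩
    dsimp only at h1 h2 h3 h4 ⊢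
    have hx0 : 0 < x := hm0.trans_le h1
    refine ⟨?_, ?_, ?_⟩
    · rw [← Real.sq_sqrt hs0.le]; gcongr
    · calc y ^ 2 ≤ (√q * x) ^ 2 := by gcongr
        _ = q * x ^ 2 := by rw [mul_pow, Real.sq_sqrt hq.le]
    · calc (1 + q) * x ^ 2 ≤ (1 + q) * X ^ 2 := by gcongr
        _ = P := by rw [hX, Real.sq_sqrt (by positivity)]; field_simp
  have hTD : T ⊆ D := fun v hv => by
    obtain ⟨h1, h2, h3⟩ := hTsq v hv
    show v.1 ^ 2 + v.2 ^ 2 ≤ P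
    linarith
  have hTm : MeasurableSet T := (isClosed_trapezoid (√s) X √q).measurableSet
  have hTF : ∀ v ∈ T, (3 * q * v.1 ^ 2)⁻¹ ≤ F v := by
    intro v hv
    obtain ⟨h1, h2, h3⟩ := hTsq v hv
    have hvD : v.1 ^ 2 + v.2 ^ 2 ≤ P := hTD hv
    refine inv_anti₀ (hFden v) ?_
    have hle1 : s + v.1 ^ 2 + v.2 ^ 2 ≤ 1 := by nlinarith
    have hlogle : |Real.log (s + v.1 ^ 2 + v.2 ^ 2)| ≤ M := by
      rw [abs_of_nonpos (Real.log_nonpos (by positivity) hle1), hMdef, neg_le_neg_iff]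
      exact Real.log_le_log hs0 (by nlinarith [sq_nonneg v.1, sq_nonneg v.2])
    have h4 : 1 + |Real.log (s + v.1 ^ 2 + v.2 ^ 2)| ^ κ ≤ q := by rw [hqdef]; gcongr
    have h5 : (a ^ 2 + v.1 ^ 2) * (1 + |Real.log (s + v.1 ^ 2 + v.2 ^ 2)| ^ κ) ≤
        (a ^ 2 + v.1 ^ 2) * q := by gcongr
    have h6 : (l + b ^ 2) * 1 ≤ (l + b ^ 2) * q := by gcongr; linarith
    have h7 : s * q ≤ v.1 ^ 2 * q := by gcongr
    rw [hsdef] at h7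
    linarith
  have hmain : (3 * √q)⁻¹ * Real.log (X / √s) ≤ ∫ v in D, F v := by
    rw [← hgval]
    calc _ ≤ ∫ v in T, F v := setIntegral_mono_on hgint (hFint.mono_set hTD) hTm hTF
      _ ≤ ∫ v in D, F v := setIntegral_mono_set hFint
          (Filter.Eventually.of_forall fun v => inv_nonneg.2 (hFden v).le) hTD.eventuallyLE
  refine le_trans ?_ hmain
  have hsqrt : √q ≤ 2 * M ^ (κ / 2) := by
    rw [Real.sqrt_le_left (by positivity), mul_pow, ← Real.rpow_natCast (M ^ (κ / 2)),
      ← Real.rpow_mul hM0.le]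
    norm_num
    linarith
  have hh : 0 < M ^ (κ / 2) := by positivity
  have hsq : 0 < √q := by positivity
  rw [habs, Real.rpow_sub hM0, Real.rpow_one]
  calc (96 : ℝ)⁻¹ * (M / M ^ (κ / 2)) = (3 * (2 * M ^ (κ / 2)))⁻¹ * (M / 16) := by
        field_simp; norm_num
    _ ≤ (3 * √q)⁻¹ * Real.log (X / √s) := by gcongr

/-- lower bound of Lemma `le:up`. For `0 ≤ κ ≤ 1 < τ` there are `C > 0`
and `λ₀ ∈ (0,1/2)` such that for `λ ∈ (0,λ₀)` and `a² + b² ≤ |log λ|^{−4τ}`, the integral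
`K = ∫∫_{x²+y² ≤ |log λ|^{−2τ}} [λ + b² + y² + (a²+x²)(1 + |log(λ+a²+b²+x²+y²)|^κ)]⁻¹ dx dy`
satisfies `K ≥ C⁻¹·|log(λ+a²+b²)|^{1−κ/2}`. -/
theorem stmt2 (κ τ : ℝ) (hκ0 : 0 ≤ κ) (hκ1 : κ ≤ 1) (hτ : 1 < τ) :
    ∃ C : ℝ, 0 < C ∧ ∃ lam0 : ℝ, 0 < lam0 ∧ lam0 < 1 / 2 ∧
      ∀ l : ℝ, 0 < l → l < lam0 → ∀ a b : ℝ,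
        a ^ 2 + b ^ 2 ≤ |Real.log l| ^ (-(4 * τ)) →
        C⁻¹ * |Real.log (l + a ^ 2 + b ^ 2)| ^ (1 - κ / 2) ≤
          ∫ v in {v : ℝ × ℝ | v.1 ^ 2 + v.2 ^ 2 ≤ |Real.log l| ^ (-(2 * τ))},
            (l + b ^ 2 + v.2 ^ 2 +
              (a ^ 2 + v.1 ^ 2) *
                (1 + |Real.log (l + a ^ 2 + b ^ 2 + v.1 ^ 2 + v.2 ^ 2)| ^ κ))⁻¹ := by
  have hlim : ∀ᶠ L : ℝ in Filter.atTop, 4 * τ * Real.log L ≤ L := by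
    have hc : 0 < (4 * τ)⁻¹ := by positivity
    filter_upwards [Real.isLittleO_log_id_atTop.bound hc, Filter.eventually_ge_atTop 1] with L h h1
    have h0 : 0 ≤ Real.log L := Real.log_nonneg h1
    rw [Real.norm_of_nonneg h0, id, Real.norm_of_nonneg (by linarith)] at h
    calc 4 * τ * Real.log L ≤ 4 * τ * ((4 * τ)⁻¹ * L) := by gcongr
      _ = L := by field_simp
  obtain ⟨L0, hL0⟩ := Filter.eventually_atTop.1 hlim
  refine ⟨96, by norm_num, Real.exp (-max L0 (Real.exp 6)), Real.exp_pos _, ?_, ?_⟩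
  · have h1 : (7 : ℝ) ≤ max L0 (Real.exp 6) :=
      le_max_of_le_right (by linarith [Real.add_one_le_exp (6 : ℝ)])
    rw [Real.exp_neg, inv_lt_comm₀ (Real.exp_pos _) (by norm_num)]
    linarith [Real.add_one_le_exp (max L0 (Real.exp 6))]
  intro l hl hl0 a b hab
  set L := |Real.log l| with hL
  have hlog : Real.log l < -max L0 (Real.exp 6) := by
    rwa [Real.log_lt_iff_lt_exp hl]
  have hLlog : L = -Real.log l := abs_of_neg (hlog.trans (by
    linarith [le_max_right L0 (Real.exp 6), Real.exp_pos 6]))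
  have hL1 : L0 ≤ L := by linarith [le_max_left L0 (Real.exp 6)]
  have hL6 : Real.exp 6 ≤ L := by linarith [le_max_right L0 (Real.exp 6)]
  have hLpos : 0 < L := (Real.exp_pos 6).trans_le hL6
  have hlogL : 6 ≤ Real.log L := (Real.le_log_iff_exp_le hLpos).2 hL6
  have hP0 : 0 < L ^ (-(2 * τ)) := by positivity
  have hPlog : Real.log (L ^ (-(2 * τ))) = -(2 * τ) * Real.log L := Real.log_rpow hLpos _
  have hPsq : L ^ (-(4 * τ)) = (L ^ (-(2 * τ))) ^ 2 := by
    rw [← Real.rpow_natCast, ← Real.rpow_mul hLpos.le]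
    congr 1
    push_cast
    ring
  have hlP : l ≤ (L ^ (-(2 * τ))) ^ 2 := by
    rw [← Real.log_le_log_iff hl (by positivity), Real.log_pow, hPlog]
    have := hL0 L hL1
    push_cast
    linarith
  have hlog2 := Real.log_two_lt_d9
  have hs : l + a ^ 2 + b ^ 2 ≤ 2 * (L ^ (-(2 * τ))) ^ 2 := by
    rw [hPsq] at hab
    linarith
  refine rpow_le_setIntegral_disk hκ0 hκ1 hl hP0 ?_ hs ?_
  · rw [← Real.log_le_log_iff hP0 (by norm_num), hPlog, one_div, Real.log_inv]
    nlinarith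
  · have h := Real.log_le_log (by positivity) hs
    rw [Real.log_mul (by norm_num) (by positivity), Real.log_pow, hPlog] at h
    push_cast at h
    nlinarith
end
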